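/- Let W = {(ψ₁,φ₁,φ₂) ∈ ℝ³ : ψ₁ > 0, 2φ₁ − φ₂ > 0, −φ₁ + 2φ₂ > 0} be the open dual fundamental Weyl chamber of A₁⊕A₂, and let l₁ = −φ₁+φ₂, l₂ = −ψ₁−φ₁+φ₂, l₃ = −ψ₁+φ₁, l₄ = ψ₁−φ₂, l₅ = ψ₁−φ₁+φ₂ be the five weight linear forms cutting the interior of W. Then the set of sign vectors (sgn l₁, sgn l₂, sgn l₃, sgn l₄, sgn l₅) attained at points of W where all five forms are nonzero is exactly the eight-element set {(+,−,−,+,+), (+,−,−,−,+), (+,−,+,−,+), (+,+,+,−,+), (−,−,−,+,+), (−,−,+,+,+), (−,−,+,−,+), (−,−,+,−,−)}; in particular, the hyperplane arrangement I(A₁⊕A₂, (1,3)⊕(2,3)) has exactly eight chambers. -/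

import Mathlib

/-- The set of sign vectors of the five weight linear forms
`l₁ = −φ₁+φ₂`, `l₂ = −ψ₁−φ₁+φ₂`, `l₃ = −ψ₁+φ₁`, `l₄ = ψ₁−φ₂`, `l₅ = ψ₁−φ₁+φ₂`
attained at points of the open dual fundamental Weyl chamber
`W = {ψ₁ > 0, 2φ₁−φ₂ > 0, −φ₁+2φ₂ > 0}` where all five forms are nonzero
is exactly the eight-element set corresponding to the eight chambers of the
hyperplane arrangement I(A₁⊕A₂, (1,3)⊕(2,3)). -/
theorem su2su3_hyperplane_arrangement_eight_chambers :
    {v : ℝ × ℝ × ℝ × ℝ × ℝ |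
      ∃ ψ₁ φ₁ φ₂ : ℝ,
        0 < ψ₁ ∧ 0 < 2 * φ₁ - φ₂ ∧ 0 < -φ₁ + 2 * φ₂ ∧
        -φ₁ + φ₂ ≠ 0 ∧ -ψ₁ - φ₁ + φ₂ ≠ 0 ∧ -ψ₁ + φ₁ ≠ 0 ∧
        ψ₁ - φ₂ ≠ 0 ∧ ψ₁ - φ₁ + φ₂ ≠ 0 ∧
        v = (Real.sign (-φ₁ + φ₂), Real.sign (-ψ₁ - φ₁ + φ₂),
             Real.sign (-ψ₁ + φ₁), Real.sign (ψ₁ - φ₂),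
             Real.sign (ψ₁ - φ₁ + φ₂))} =
    {(1, -1, -1, 1, 1), (1, -1, -1, -1, 1), (1, -1, 1, -1, 1), (1, 1, 1, -1, 1),
     (-1, -1, -1, 1, 1), (-1, -1, 1, 1, 1), (-1, -1, 1, -1, 1), (-1, -1, 1, -1, -1)} := by
  ext v
  simp only [Set.mem_ofPred_eq, Set.mem_insert_iff, Set.mem_singleton_iff]
  constructor
  · rintro ⟨ψ₁, φ₁, φ₂, hψ, hα, hβ, h₁, h₂, h₃, h₄, h₅, rfl⟩
    rcases lt_or_gt_of_ne h₁ with h₁ | h₁ <;>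
    rcases lt_or_gt_of_ne h₂ with h₂ | h₂ <;>
    rcases lt_or_gt_of_ne h₃ with h₃ | h₃ <;>
    rcases lt_or_gt_of_ne h₄ with h₄ | h₄ <;>
    rcases lt_or_gt_of_ne h₅ with h₅ | h₅ <;>
    first
    | (exfalso; linarith)
    | (simp only [Real.sign_of_neg, Real.sign_of_pos, h₁, h₂, h₃, h₄, h₅]
       simp)
  · rintro (rfl | rfl | rfl | rfl | rfl | rfl | rfl | rfl)
    · refine ⟨4, 2, 3, ?_⟩
      norm_num [Real.sign]
    · refine ⟨5 / 2, 2, 3, ?_⟩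
      norm_num [Real.sign]
    · refine ⟨3 / 2, 2, 3, ?_⟩
      norm_num [Real.sign]
    · refine ⟨1 / 2, 2, 3, ?_⟩
      norm_num [Real.sign]
    · refine ⟨4, 3, 2, ?_⟩
      norm_num [Real.sign]
    · refine ⟨5 / 2, 3, 2, ?_⟩
      norm_num [Real.sign]
    · refine ⟨3 / 2, 3, 2, ?_⟩
      norm_num [Real.sign]
    · refine ⟨1 / 2, 3, 2, ?_⟩
      norm_num [Real.sign]
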